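/- arXiv:2409.16688 — 2 statements merged into one kernel-verified Lean document; each statement's English description precedes it below -/
import Mathlib

section
/- For every k ≥ 2, a finite simple graph G on n vertices with degeneracy δ whose vertices are indexed in non-increasing order of degree contains at most O(δ^{k+1} n^{k−1}) cycles of length 2k having three consecutive vertices with monotonic indices. -/
open SimpleGraph Finset MeasureTheory ProbabilityTheory

/-- The arboricity of a graph: the minimal number `k` such that the edge set of `G`
can be partitioned into `k` forests. -/
noncomputable def arboricity {V : Type*} (G : SimpleGraph V) : ℕ :=
  sInf {k : ℕ | ∃ f : Sym2 V → Fin k,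
    ∀ i : Fin k, (SimpleGraph.fromEdgeSet {e | e ∈ G.edgeSet ∧ f e = i}).IsAcyclic}

/-- The degeneracy of a graph: the smallest `d` such that every nonempty subgraph
contains a vertex of induced degree at most `d`. -/
noncomputable def degeneracy {V : Type*} [Fintype V] (G : SimpleGraph V) : ℕ :=
  sInf {d : ℕ | ∀ s : Finset V, s.Nonempty →
    ∃ v ∈ s, ((s : Set V) ∩ {u | G.Adj v u}).ncard ≤ d}

/-- The degree of a vertex. -/
noncomputable def deg {n : ℕ} (G : SimpleGraph (Fin n)) (v : Fin n) : ℕ :=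
  {u | G.Adj v u}.ncard

/-- The number of paths with `p` edges in `G`, counted once per geometric path
(tuples of `p+1` pairwise distinct vertices with consecutive vertices adjacent,
normalized up to reversal by requiring the first endpoint to be at most the last). -/
noncomputable def pathCount {n : ℕ} (G : SimpleGraph (Fin n)) (p : ℕ) : ℕ :=
  {l : Fin (p + 1) → Fin n | Function.Injective l ∧
    (∀ i : Fin p, G.Adj (l i.castSucc) (l i.succ)) ∧ l 0 ≤ l (Fin.last p)}.ncard

/-- The number of cycles of length `k` in `G`: tuples of `k` pairwise distinct vertices,
cyclically consecutive ones adjacent, counted up to rotation and reflection. -/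
noncomputable def cycleCount {n : ℕ} (G : SimpleGraph (Fin n)) (k : ℕ) : ℕ :=
  {l : Fin k → Fin n | Function.Injective l ∧
    ∀ i j : Fin k, ((i : ℕ) + 1) % k = (j : ℕ) → G.Adj (l i) (l j)}.ncard / (2 * k)

/-- Number of cycles of length `k` containing three cyclically consecutive vertices
with monotonic indices, counted up to rotation and reflection. -/
noncomputable def monoCycleCount {n : ℕ} (G : SimpleGraph (Fin n)) (k : ℕ) : ℕ :=
  {l : Fin k → Fin n | Function.Injective l ∧
    (∀ i j : Fin k, ((i : ℕ) + 1) % k = (j : ℕ) → G.Adj (l i) (l j)) ∧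
    ∃ i j t : Fin k, ((i : ℕ) + 1) % k = (j : ℕ) ∧ ((j : ℕ) + 1) % k = (t : ℕ) ∧
      ((l i < l j ∧ l j < l t) ∨ (l t < l j ∧ l j < l i))}.ncard / (2 * k)

/-- Path count extended to integer lengths, with the convention `#P_p = 1` for `p < 0`. -/
noncomputable def pathCountExt {n : ℕ} (G : SimpleGraph (Fin n)) (p : ℤ) : ℕ :=
  if 0 ≤ p then pathCount G p.toNat else 1

/-- `S₂*`: the number of low-2-stars, `∑ i, dᵢ⁻ ⬝ (dᵢ - 1)` where `dᵢ⁻` is the number of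
neighbors of `ηᵢ` with smaller index. -/
noncomputable def S2star {n : ℕ} (G : SimpleGraph (Fin n)) : ℕ :=
  ∑ i : Fin n, {j | G.Adj i j ∧ j < i}.ncard * (deg G i - 1)

/-- Orientation with out-degree bounded by the degeneracy. -/
theorem exists_out {n : ℕ} (G : SimpleGraph (Fin n)) :
    ∃ out : Fin n → Finset (Fin n), (∀ v, (out v).card ≤ degeneracy G) ∧
      ∀ u v, G.Adj u v → v ∈ out u ∨ u ∈ out v := by
  classical
  have hd : ∀ s : Finset (Fin n), s.Nonempty →
      ∃ v ∈ s, ((s : Set (Fin n)) ∩ {u | G.Adj v u}).ncard ≤ degeneracy G := by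
    have : degeneracy G ∈ {d : ℕ | ∀ s : Finset (Fin n), s.Nonempty →
        ∃ v ∈ s, ((s : Set (Fin n)) ∩ {u | G.Adj v u}).ncard ≤ d} := by
      apply Nat.sInf_mem
      refine ⟨n, ?_⟩
      intro s hs
      obtain ⟨v, hv⟩ := hs
      refine ⟨v, hv, ?_⟩
      calc _ ≤ (Set.univ : Set (Fin n)).ncard := Set.ncard_le_ncard (Set.subset_univ _)
        _ = n := by simp [Set.ncard_univ]
    exact this
  have key : ∀ m : ℕ, ∀ s : Finset (Fin n), s.card = m →
      ∃ out : Fin n → Finset (Fin n), (∀ v, (out v).card ≤ degeneracy G) ∧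
      ∀ u ∈ s, ∀ v ∈ s, G.Adj u v → v ∈ out u ∨ u ∈ out v := by
    intro m
    induction m with
    | zero =>
      intro s hs
      refine ⟨fun _ => ∅, by simp, ?_⟩
      rw [Finset.card_eq_zero] at hs
      subst hs
      simp
    | succ m ih =>
      intro s hs
      obtain ⟨x, hx, hxd⟩ := hd s (Finset.card_pos.mp (by omega))
      obtain ⟨out, h1, h2⟩ := ih (s.erase x) (by rw [Finset.card_erase_of_mem hx]; omega)
      have hc : (s.filter (fun u => G.Adj x u)).card ≤ degeneracy G := by
        rw [← Set.ncard_coe_finset]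
        convert hxd using 2
        ext u; simp
      refine ⟨fun v => if v = x then s.filter (fun u => G.Adj x u) else out v, ?_, ?_⟩
      · intro v
        dsimp only
        split_ifs
        · exact hc
        · exact h1 v
      · intro u hu v hv huv
        by_cases hux : u = x
        · left; subst hux; simp [hv, huv]
        · by_cases hvx : v = x
          · right; subst hvx; simp [hu, huv.symm]
          · simp only [hux, hvx, if_false]
            exact h2 u (by simp [hux, hu]) v (by simp [hvx, hv]) huv
  obtain ⟨out, h1, h2⟩ := key _ Finset.univ rfl
  exact ⟨out, h1, fun u v h => h2 u (Finset.mem_univ _) v (Finset.mem_univ _) h⟩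

open Classical in
/-- ordered adjacent pairs -/
noncomputable def darts {n : ℕ} (G : SimpleGraph (Fin n)) : Finset (Fin n × Fin n) :=
  Finset.univ.filter (fun p => G.Adj p.1 p.2)

open Classical in
/-- low stars -/
noncomputable def lowStars {n : ℕ} (G : SimpleGraph (Fin n)) :
    Finset (Fin n × Fin n × Fin n) :=
  Finset.univ.filter (fun p => G.Adj p.1 p.2.1 ∧ p.1 < p.2.1 ∧ G.Adj p.2.1 p.2.2)

theorem sum_deg {n : ℕ} (G : SimpleGraph (Fin n)) : ∑ v, deg G v = (darts G).card := by
  classical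
  have : darts G = (Finset.univ : Finset (Fin n)).biUnion
      (fun v => (Finset.univ.filter (fun u => G.Adj v u)).image (fun u => (v, u))) := by
    ext ⟨a, b⟩
    simp [darts]
  rw [this, Finset.card_biUnion]
  · refine Finset.sum_congr rfl fun v _ => ?_
    rw [Finset.card_image_of_injective _ (fun a b h => by simpa using h),
      ← Set.ncard_coe_finset, deg]
    congr 1
    ext; simp
  · intro x _ y _ hxy
    simp only [Function.onFun]
    rw [Finset.disjoint_left]
    rintro ⟨a, b⟩ h1 h2
    simp only [Finset.mem_image, Prod.mk.injEq] at h1 h2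
    obtain ⟨_, _, h1, _⟩ := h1
    obtain ⟨_, _, h2, _⟩ := h2
    exact hxy (h1.trans h2.symm)

theorem darts_card {n : ℕ} (G : SimpleGraph (Fin n)) :
    (darts G).card ≤ 2 * degeneracy G * n := by
  classical
  obtain ⟨out, h1, h2⟩ := exists_out G
  have hs : ((Finset.univ : Finset (Fin n)).sigma out).card ≤ degeneracy G * n := by
    rw [Finset.card_sigma]
    calc _ ≤ ∑ _v : Fin n, degeneracy G := Finset.sum_le_sum fun v _ => h1 v
      _ = _ := by simp [mul_comm]
  have : darts G ⊆ ((Finset.univ : Finset (Fin n)).sigma out).image (fun p => (p.1, p.2)) ∪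
      ((Finset.univ : Finset (Fin n)).sigma out).image (fun p => (p.2, p.1)) := by
    rintro ⟨a, b⟩ h
    simp only [darts, Finset.mem_filter, Finset.mem_univ, true_and] at h
    rw [Finset.mem_union]
    rcases h2 a b h with h | h
    · left; exact Finset.mem_image.mpr ⟨⟨a, b⟩, by simpa using h, rfl⟩
    · right; exact Finset.mem_image.mpr ⟨⟨b, a⟩, by simpa using h, rfl⟩
  calc _ ≤ _ := Finset.card_le_card this
    _ ≤ _ := Finset.card_union_le _ _
    _ ≤ degeneracy G * n + degeneracy G * n :=
        add_le_add (Finset.card_image_le.trans hs) (Finset.card_image_le.trans hs)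
    _ = _ := by ring

theorem lowStars_card {n : ℕ} (G : SimpleGraph (Fin n))
    (hG : ∀ i j : Fin n, j < i → deg G i ≤ deg G j) :
    (lowStars G).card ≤ 4 * degeneracy G ^ 2 * n := by
  classical
  obtain ⟨out, h1, h2⟩ := exists_out G
  obtain ⟨E, hEm⟩ : ∃ E : Finset (Fin n × Fin n), ∀ p, p ∈ E ↔ G.Adj p.1 p.2 ∧ p.1 < p.2 :=
    ⟨Finset.univ.filter (fun p => G.Adj p.1 p.2 ∧ p.1 < p.2), by simp⟩
  have hcard : ∀ v, (Finset.univ.filter (fun u => G.Adj v u)).card = deg G v := by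
    intro v
    rw [← Set.ncard_coe_finset, deg]
    congr 1
    ext; simp
  have hL : (lowStars G).card ≤ ∑ p ∈ E, deg G p.2 := by
    have : lowStars G ⊆ (E.sigma (fun p => Finset.univ.filter (fun u => G.Adj p.2 u))).image
        (fun q => (q.1.1, q.1.2, q.2)) := by
      rintro ⟨a, b, c⟩ h
      simp only [lowStars, Finset.mem_filter, Finset.mem_univ, true_and] at h
      exact Finset.mem_image.mpr ⟨⟨(a, b), c⟩, by simp [hEm, h], rfl⟩
    calc _ ≤ _ := Finset.card_le_card this
      _ ≤ _ := Finset.card_image_le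
      _ = _ := by
        rw [Finset.card_sigma]
        exact Finset.sum_congr rfl fun p _ => hcard p.2
  have hE : E ⊆ E.filter (fun p => p.2 ∈ out p.1) ∪ E.filter (fun p => p.1 ∈ out p.2) := by
    rintro ⟨a, b⟩ h
    have h' := h
    rw [hEm] at h'
    rw [Finset.mem_union]
    rcases h2 a b h'.1 with h3 | h3
    · exact Or.inl (Finset.mem_filter.mpr ⟨h, h3⟩)
    · exact Or.inr (Finset.mem_filter.mpr ⟨h, h3⟩)
  have hS : ∑ q ∈ (Finset.univ : Finset (Fin n)).sigma out, deg G q.1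
      ≤ degeneracy G * (2 * degeneracy G * n) := by
    rw [Finset.sum_sigma]
    calc _ ≤ ∑ v, degeneracy G * deg G v := by
          refine Finset.sum_le_sum fun v _ => ?_
          simp only [Finset.sum_const, smul_eq_mul]
          exact Nat.mul_le_mul_right _ (h1 v)
      _ = degeneracy G * (darts G).card := by rw [← Finset.mul_sum, sum_deg]
      _ ≤ _ := Nat.mul_le_mul_left _ (darts_card G)
  have hA : ∑ p ∈ E.filter (fun p => p.2 ∈ out p.1), deg G p.2
      ≤ ∑ q ∈ (Finset.univ : Finset (Fin n)).sigma out, deg G q.1 := by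
    calc _ ≤ ∑ p ∈ E.filter (fun p => p.2 ∈ out p.1), deg G p.1 := by
          refine Finset.sum_le_sum fun p hp => ?_
          rw [Finset.mem_filter, hEm] at hp
          exact hG _ _ hp.1.2
      _ = ∑ q ∈ (E.filter (fun p => p.2 ∈ out p.1)).image
            (fun p => (⟨p.1, p.2⟩ : (_ : Fin n) × Fin n)), deg G q.1 := by
          rw [Finset.sum_image]
          rintro ⟨a, b⟩ _ ⟨c, d⟩ _ h
          simpa using h
      _ ≤ _ := by
          apply Finset.sum_le_sum_of_subset
          intro q hq
          obtain ⟨p, hp, rfl⟩ := Finset.mem_image.mp hq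
          simpa using (Finset.mem_filter.mp hp).2
  have hB : ∑ p ∈ E.filter (fun p => p.1 ∈ out p.2), deg G p.2
      ≤ ∑ q ∈ (Finset.univ : Finset (Fin n)).sigma out, deg G q.1 := by
    calc _ = ∑ q ∈ (E.filter (fun p => p.1 ∈ out p.2)).image
            (fun p => (⟨p.2, p.1⟩ : (_ : Fin n) × Fin n)), deg G q.1 := by
          rw [Finset.sum_image]
          rintro ⟨a, b⟩ _ ⟨c, d⟩ _ h
          simp at h
          simp [h]
      _ ≤ _ := by
          apply Finset.sum_le_sum_of_subset
          intro q hq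
          obtain ⟨p, hp, rfl⟩ := Finset.mem_image.mp hq
          simpa using (Finset.mem_filter.mp hp).2
  calc _ ≤ _ := hL
    _ ≤ _ := Finset.sum_le_sum_of_subset hE
    _ ≤ ∑ p ∈ E.filter (fun p => p.2 ∈ out p.1), deg G p.2 +
          ∑ p ∈ E.filter (fun p => p.1 ∈ out p.2), deg G p.2 := by
        rw [← Finset.sum_union_inter]
        exact Nat.le_add_right _ _
    _ ≤ degeneracy G * (2 * degeneracy G * n) + degeneracy G * (2 * degeneracy G * n) :=
        add_le_add (hA.trans hS) (hB.trans hS)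
    _ = _ := by ring

/-- generic counting -/
theorem count_aux {α β : Type*} {n : ℕ} {d : ℕ} (out : Fin n → Finset (Fin n))
    (h1 : ∀ v, (out v).card ≤ d) (S : Finset α) (Q : Finset β) (φ : α → β) (x : α → Fin n)
    (g : β → Fin n) (hφ : ∀ a ∈ S, φ a ∈ Q) (hx : ∀ a ∈ S, x a ∈ out (g (φ a)))
    (hinj : ∀ a ∈ S, ∀ b ∈ S, φ a = φ b → x a = x b → a = b) :
    S.card ≤ Q.card * d := by
  classical
  calc S.card ≤ (Q.sigma (fun q => out (g q))).card := by
        apply Finset.card_le_card_of_injOn (fun a => (⟨φ a, x a⟩ : (_ : β) × Fin n))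
        · intro a ha
          simp only [Finset.coe_sigma, Set.mem_sigma_iff, Finset.mem_coe]
          exact ⟨hφ a ha, hx a ha⟩
        · intro a ha b hb h
          simp at h
          exact hinj a ha b hb h.1 h.2
    _ = ∑ q ∈ Q, (out (g q)).card := Finset.card_sigma _ _
    _ ≤ ∑ _q ∈ Q, d := Finset.sum_le_sum fun q _ => h1 _
    _ = _ := by simp

/-- codes: a low star and `r` darts -/
noncomputable def codes {n : ℕ} (G : SimpleGraph (Fin n)) (r : ℕ) :
    Finset ((Fin n × Fin n × Fin n) × (Fin r → Fin n × Fin n)) :=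
  lowStars G ×ˢ Fintype.piFinset (fun _ => darts G)

theorem codes_card {n : ℕ} (G : SimpleGraph (Fin n)) (r : ℕ)
    (hG : ∀ i j : Fin n, j < i → deg G i ≤ deg G j) :
    (codes G r).card ≤ (4 * degeneracy G ^ 2 * n) * (2 * degeneracy G * n) ^ r := by
  rw [codes, Finset.card_product, Fintype.card_piFinset]
  simp only [Finset.prod_const, Finset.card_univ, Fintype.card_fin]
  exact Nat.mul_le_mul (lowStars_card G hG) (Nat.pow_le_pow_left (darts_card G) r)

open Classical in
/-- cyclic tuples starting with an increasing triple -/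
noncomputable def cyc0 {n : ℕ} (G : SimpleGraph (Fin n)) (r : ℕ) :
    Finset (Fin (2 * r + 4) → Fin n) :=
  Finset.univ.filter (fun w => (∀ i, G.Adj (w i) (w (i + 1))) ∧
    w ⟨0, by omega⟩ < w ⟨1, by omega⟩ ∧ w ⟨1, by omega⟩ < w ⟨2, by omega⟩)

theorem cyc0_adj {n : ℕ} {G : SimpleGraph (Fin n)} {r : ℕ} {w : Fin (2 * r + 4) → Fin n}
    (h : ∀ i, G.Adj (w i) (w (i + 1))) (t s : ℕ) (hs : s < 2 * r + 4) (hts : s = t + 1) :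
    G.Adj (w ⟨t, by omega⟩) (w ⟨s, hs⟩) := by
  subst hts
  have := h ⟨t, by omega⟩
  convert this using 2
  ext
  simp [Fin.val_add, Nat.mod_eq_of_lt hs]

theorem cyc0_card {n : ℕ} (G : SimpleGraph (Fin n)) (r : ℕ)
    (hG : ∀ i j : Fin n, j < i → deg G i ≤ deg G j) :
    (cyc0 G r).card ≤
      2 * ((4 * degeneracy G ^ 2 * n) * (2 * degeneracy G * n) ^ r * degeneracy G) := by
  classical
  obtain ⟨out, h1, h2⟩ := exists_out G
  let A := (cyc0 G r).filter (fun w => w ⟨2 * r + 3, by omega⟩ ∈ out (w ⟨0, by omega⟩))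
  let B := (cyc0 G r).filter (fun w => w ⟨0, by omega⟩ ∈ out (w ⟨2 * r + 3, by omega⟩))
  have hsub : cyc0 G r ⊆ A ∪ B := by
    intro w hw
    have hw' := hw
    simp only [cyc0, Finset.mem_filter, Finset.mem_univ, true_and] at hw'
    have hadj : G.Adj (w ⟨2 * r + 3, by omega⟩) (w ⟨0, by omega⟩) := by
      convert hw'.1 ⟨2 * r + 3, by omega⟩ using 2
      ext
      simp [Fin.val_add]
    rw [Finset.mem_union, Finset.mem_filter, Finset.mem_filter]
    rcases h2 _ _ hadj with h | h
    · exact Or.inr ⟨hw, h⟩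
    · exact Or.inl ⟨hw, h⟩
  have hA : A.card ≤ (codes G r).card * degeneracy G := by
    apply count_aux out h1 A (codes G r)
      (fun w => ((w ⟨0, by omega⟩, w ⟨1, by omega⟩, w ⟨2, by omega⟩),
        fun j => (w ⟨3 + 2 * j, by omega⟩, w ⟨4 + 2 * j, by omega⟩)))
      (fun w => w ⟨2 * r + 3, by omega⟩) (fun q => q.1.1)
    · intro w hw
      simp only [A, cyc0, Finset.mem_filter, Finset.mem_univ, true_and] at hw
      simp only [codes, Finset.mem_product, Fintype.mem_piFinset, lowStars, darts,
        Finset.mem_filter, Finset.mem_univ, true_and]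
      refine ⟨⟨cyc0_adj hw.1.1 _ _ _ (by omega), hw.1.2.1, cyc0_adj hw.1.1 _ _ _ (by omega)⟩,
        fun j => cyc0_adj hw.1.1 _ _ _ (by omega)⟩
    · intro w hw
      exact (Finset.mem_filter.mp hw).2
    · intro a _ b _ hab hx
      simp only [Prod.mk.injEq, funext_iff] at hab
      obtain ⟨⟨e0, e1, e2⟩, e⟩ := hab
      ext ⟨t, ht⟩ : 1
      by_cases c0 : t = 0
      · subst c0; exact e0
      by_cases c1 : t = 1
      · subst c1; exact e1
      by_cases c2 : t = 2
      · subst c2; exact e2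
      by_cases c3 : t = 2 * r + 3
      · subst c3; exact hx
      rcases Nat.even_or_odd' t with ⟨m, hm | hm⟩
      · obtain ⟨q, rfl⟩ : ∃ q, t = 4 + 2 * q := ⟨m - 2, by omega⟩
        exact (e ⟨q, by omega⟩).2
      · obtain ⟨q, rfl⟩ : ∃ q, t = 3 + 2 * q := ⟨m - 1, by omega⟩
        exact (e ⟨q, by omega⟩).1
  have hB : B.card ≤ (codes G r).card * degeneracy G := by
    apply count_aux out h1 B (codes G r)
      (fun w => ((w ⟨1, by omega⟩, w ⟨2, by omega⟩, w ⟨3, by omega⟩),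
        fun j => (w ⟨4 + 2 * j, by omega⟩, w ⟨5 + 2 * j, by omega⟩)))
      (fun w => w ⟨0, by omega⟩)
      (fun q => if h : 0 < r then (q.2 ⟨r - 1, by omega⟩).2 else q.1.2.2)
    · intro w hw
      simp only [B, cyc0, Finset.mem_filter, Finset.mem_univ, true_and] at hw
      simp only [codes, Finset.mem_product, Fintype.mem_piFinset, lowStars, darts,
        Finset.mem_filter, Finset.mem_univ, true_and]
      refine ⟨⟨cyc0_adj hw.1.1 _ _ _ (by omega), hw.1.2.2, cyc0_adj hw.1.1 _ _ _ (by omega)⟩,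
        fun j => cyc0_adj hw.1.1 _ _ _ (by omega)⟩
    · intro w hw
      have := (Finset.mem_filter.mp hw).2
      dsimp only
      split_ifs with h
      · have e : 5 + 2 * (r - 1) = 2 * r + 3 := by omega
        simpa only [e] using this
      · have e : 2 * r + 3 = 3 := by omega
        simpa only [e] using this
    · intro a _ b _ hab hx
      simp only [Prod.mk.injEq, funext_iff] at hab
      obtain ⟨⟨e0, e1, e2⟩, e⟩ := hab
      ext ⟨t, ht⟩ : 1
      by_cases c0 : t = 0
      · subst c0; exact hx
      by_cases c1 : t = 1
      · subst c1; exact e0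
      by_cases c2 : t = 2
      · subst c2; exact e1
      by_cases c3 : t = 3
      · subst c3; exact e2
      rcases Nat.even_or_odd' t with ⟨m, hm | hm⟩
      · obtain ⟨q, rfl⟩ : ∃ q, t = 4 + 2 * q := ⟨m - 2, by omega⟩
        exact (e ⟨q, by omega⟩).1
      · obtain ⟨q, rfl⟩ : ∃ q, t = 5 + 2 * q := ⟨m - 2, by omega⟩
        exact (e ⟨q, by omega⟩).2
  have hc := Nat.mul_le_mul_right (degeneracy G) (codes_card G r hG)
  calc _ ≤ _ := Finset.card_le_card hsub
    _ ≤ _ := Finset.card_union_le _ _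
    _ ≤ _ := add_le_add (hA.trans hc) (hB.trans hc)
    _ = _ := by ring

theorem mono_le {n : ℕ} (G : SimpleGraph (Fin n)) (r : ℕ) :
    monoCycleCount G (2 * r + 4) ≤ (2 * r + 4) * 2 * (cyc0 G r).card := by
  classical
  have hsucc : ∀ a b : Fin (2 * r + 4), ((a : ℕ) + 1) % (2 * r + 4) = (b : ℕ) → b = a + 1 := by
    intro a b h
    ext
    rw [← h]
    simp [Fin.val_add]
  have hsucc' : ∀ a : Fin (2 * r + 4), ((a : ℕ) + 1) % (2 * r + 4) = ((a + 1 : Fin _) : ℕ) := by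
    intro a
    simp [Fin.val_add]
  have z0 : (⟨0, by omega⟩ : Fin (2 * r + 4)) = 0 := rfl
  have z1 : (⟨1, by omega⟩ : Fin (2 * r + 4)) = 1 := rfl
  have z2 : (⟨2, by omega⟩ : Fin (2 * r + 4)) = 1 + 1 := by
    ext
    simp [Fin.val_add]
    rw [Nat.mod_eq_of_lt (by omega)]
  let F : (Fin (2 * r + 4) × Bool) × (Fin (2 * r + 4) → Fin n) → (Fin (2 * r + 4) → Fin n) :=
    fun q t => if q.1.2 then q.2 (t - q.1.1) else q.2 (q.1.1 - t)
  unfold monoCycleCount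
  refine (Nat.div_le_self _ _).trans ?_
  calc _ ≤ ((((Finset.univ : Finset (Fin (2 * r + 4) × Bool)) ×ˢ cyc0 G r).image F :
        Finset _) : Set (Fin (2 * r + 4) → Fin n)).ncard := by
        apply Set.ncard_le_ncard _ (Finset.finite_toSet _)
        rintro l ⟨_, hadj, i, j, t, hij, hjt, h⟩
        have hadj' : ∀ a, G.Adj (l a) (l (a + 1)) := fun a => hadj _ _ (hsucc' a)
        have hj := hsucc _ _ hij
        have ht := hsucc _ _ hjt
        rw [Finset.mem_coe, Finset.mem_image]
        rcases h with h | h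
        · refine ⟨((i, true), fun x => l (i + x)), ?_, ?_⟩
          · simp only [Finset.mem_product, Finset.mem_univ, true_and, cyc0, Finset.mem_filter]
            refine ⟨fun x => ?_, ?_, ?_⟩
            · rw [← add_assoc]; exact hadj' _
            · rw [z0, z1, add_zero, ← hj]; exact h.1
            · rw [z1, z2, ← add_assoc, ← hj, ← ht]; exact h.2
          · funext x
            simp [F]
        · refine ⟨((t, false), fun x => l (t - x)), ?_, ?_⟩
          · have ht1 : t - 1 = j := by rw [ht]; abel
            have hj1 : j - 1 = i := by rw [hj]; abel
            simp only [Finset.mem_product, Finset.mem_univ, true_and, cyc0, Finset.mem_filter]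
            refine ⟨fun x => ?_, ?_, ?_⟩
            · have := hadj' (t - (x + 1))
              rw [show t - (x + 1) + 1 = t - x by abel] at this
              exact this.symm
            · rw [z0, z1, sub_zero, ht1]; exact h.1
            · rw [z1, z2, ← sub_sub, ht1, hj1]; exact h.2
          · funext x
            simp [F]
    _ ≤ _ := by
        rw [Set.ncard_coe_finset]
        refine Finset.card_image_le.trans ?_
        rw [Finset.card_product]
        simp

/-- For `k ≥ 2`, a graph on `n` vertices with degeneracy `δ` whose vertices are indexed
in non-increasing order of degree contains `O(δ^(k+1) n^(k-1))` cycles of length `2k`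
having three consecutive vertices with monotonic indices. -/
theorem monoCycleCount_bigO (k : ℕ) (hk : 2 ≤ k) :
    ∃ C : ℕ, ∀ (n : ℕ) (G : SimpleGraph (Fin n)),
      (∀ i j : Fin n, j < i → deg G i ≤ deg G j) →
      monoCycleCount G (2 * k) ≤ C * degeneracy G ^ (k + 1) * n ^ (k - 1) := by
  obtain ⟨r, rfl⟩ : ∃ r, k = r + 2 := ⟨k - 2, by omega⟩
  refine ⟨(2 * r + 4) * 2 * (8 * 2 ^ r), fun n G hG => ?_⟩
  have h1 := mono_le G r
  have h2 := Nat.mul_le_mul_left ((2 * r + 4) * 2) (cyc0_card G r hG)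
  have e : 2 * (r + 2) = 2 * r + 4 := by ring
  rw [e, show r + 2 - 1 = r + 1 by omega]
  refine (h1.trans h2).trans (le_of_eq ?_)
  rw [mul_pow, mul_pow]
  ring
end

section
/- Fix p ∈ ℕ and a finite simple graph G on n vertices with degeneracy δ whose vertices are indexed in non-increasing order of degree. Consider edge sets E ⊆ E(G) of size 2p that can be partitioned into vertex-disjoint cycles C_1,…,C_c of G (c ≥ 1), at least one of which contains three consecutive vertices of monotonic index. The number of such edge sets is O(δ^{p+1} n^{p−1}). -/
open SimpleGraph Finset MeasureTheory ProbabilityTheory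

/-- `l` is a cycle (of length at least 3) in `G`, given as a tuple of distinct vertices
with cyclically consecutive vertices adjacent. -/
def IsCycleTuple {n : ℕ} (G : SimpleGraph (Fin n)) {k : ℕ} (l : Fin k → Fin n) : Prop :=
  3 ≤ k ∧ Function.Injective l ∧
    ∀ i j : Fin k, ((i : ℕ) + 1) % k = (j : ℕ) → G.Adj (l i) (l j)

/-- The set of edges of the cycle given by the tuple `l`. -/
def cycleEdges {n k : ℕ} (l : Fin k → Fin n) : Set (Sym2 (Fin n)) :=
  {e | ∃ i j : Fin k, ((i : ℕ) + 1) % k = (j : ℕ) ∧ e = s(l i, l j)}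

/-- The cycle tuple `l` contains three cyclically consecutive vertices with monotonic
indices. -/
def HasMonoTriple {n k : ℕ} (l : Fin k → Fin n) : Prop :=
  ∃ i j t : Fin k, ((i : ℕ) + 1) % k = (j : ℕ) ∧ ((j : ℕ) + 1) % k = (t : ℕ) ∧
    ((l i < l j ∧ l j < l t) ∨ (l t < l j ∧ l j < l i))

/-- Sets of vertices built up by cheap steps; the indices `a`, `b` record that the number of
such sets is of order `δ ^ a * n ^ b`. -/
inductive Cov {n : ℕ} (G : SimpleGraph (Fin n)) (D : Fin n → Fin n → Prop) :
    ℕ → ℕ → Finset (Fin n) → Prop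
  | nil : Cov G D 0 0 ∅
  | edge {a b : ℕ} {W : Finset (Fin n)} (u v : Fin n) : Cov G D a b W → D u v →
      Cov G D (a + 1) (b + 1) (insert u (insert v W))
  | out {a b : ℕ} {W : Finset (Fin n)} (u v : Fin n) : Cov G D a b W → u ∈ W → D u v →
      Cov G D (a + 1) b (insert v W)
  | tri {a b : ℕ} {W : Finset (Fin n)} (w v u : Fin n) : Cov G D a b W → D w v →
      deg G v ≤ deg G w → G.Adj v u →
      Cov G D (a + 2) (b + 1) (insert w (insert v (insert u W)))

theorem Cov.union {n : ℕ} {G : SimpleGraph (Fin n)} {D : Fin n → Fin n → Prop}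
    {a b a' b' : ℕ} {W W' : Finset (Fin n)} (h : Cov G D a b W) (h' : Cov G D a' b' W') :
    Cov G D (a + a') (b + b') (W ∪ W') := by
  induction h' with
  | nil => simpa using h
  | edge u v _ hD ih =>
    rw [Finset.union_insert, Finset.union_insert]
    exact Cov.edge u v ih hD
  | out u v _ hu hD ih =>
    rw [Finset.union_insert]
    exact Cov.out u v ih (Finset.mem_union_right _ hu) hD
  | tri w v u _ hD hd hA ih =>
    rw [Finset.union_insert, Finset.union_insert, Finset.union_insert]
    exact Cov.tri w v u ih hD hd hA

theorem Cov.card_le {n : ℕ} {G : SimpleGraph (Fin n)} {D : Fin n → Fin n → Prop}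
    {a b : ℕ} {W : Finset (Fin n)} (h : Cov G D a b W) : W.card ≤ 2 * a := by
  induction h with
  | nil => simp
  | @edge a b W u v _ hD ih =>
    have h1 := Finset.card_insert_le u (insert v W)
    have h2 := Finset.card_insert_le v W
    omega
  | @out a b W u v _ hu hD ih =>
    have h2 := Finset.card_insert_le v W
    omega
  | @tri a b W w v u _ hD hd hA ih =>
    have h1 := Finset.card_insert_le w (insert v (insert u W))
    have h2 := Finset.card_insert_le v (insert u W)
    have h3 := Finset.card_insert_le u W
    omega

/-- The constants in the count of covering sets. -/
def covConst : ℕ → ℕ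
  | 0 => 1
  | a + 1 => (2 * a + 5) * covConst a

open Classical in
theorem sum_deg_le {n δ : ℕ} (G : SimpleGraph (Fin n)) (D : Fin n → Fin n → Prop)
    (hD : ∀ u v, G.Adj u v → D u v ∨ D v u)
    (hδ : ∀ u, (univ.filter (fun v => D u v)).card ≤ δ) :
    ∑ v, deg G v ≤ 2 * δ * n := by
  have h1 : ∑ u : Fin n, (univ.filter (fun v => D u v)).card ≤ δ * n := by
    calc _ ≤ ∑ u : Fin n, δ := Finset.sum_le_sum (fun u _ => hδ u)
      _ = δ * n := by simp [mul_comm]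
  have h2 : ∑ u : Fin n, (univ.filter (fun v => D v u)).card
      = ∑ u : Fin n, (univ.filter (fun v => D u v)).card :=
    (Finset.sum_card_bipartiteAbove_eq_sum_card_bipartiteBelow
      (s := univ) (t := univ) (fun u v => D u v)).symm
  have h3 : ∀ v, deg G v ≤ (univ.filter (fun u => D v u)).card
      + (univ.filter (fun u => D u v)).card := by
    intro v
    unfold deg
    rw [Set.ncard_eq_toFinset_card']
    refine le_trans (Finset.card_le_card ?_) (Finset.card_union_le _ _)
    intro u hu
    simp only [Set.mem_toFinset, Set.mem_ofPred_eq] at hu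
    simpa using hD v u hu
  calc _ ≤ ∑ v : Fin n, ((univ.filter (fun u => D v u)).card
      + (univ.filter (fun u => D u v)).card) := Finset.sum_le_sum (fun v _ => h3 v)
    _ ≤ δ * n + δ * n := by rw [Finset.sum_add_distrib, h2]; omega
    _ = 2 * δ * n := by ring

open Classical in
theorem card_cov_le {n δ : ℕ} (G : SimpleGraph (Fin n)) (D : Fin n → Fin n → Prop)
    (hD : ∀ u v, G.Adj u v → D u v ∨ D v u)
    (hδ : ∀ u, (univ.filter (fun v => D u v)).card ≤ δ) (a : ℕ) :
    ∀ b, (univ.filter (fun W => Cov G D a b W)).card ≤ covConst a * δ ^ a * n ^ b := by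
  induction a using Nat.strong_induction_on with
  | _ a ih =>
  intro b
  -- the edge steps
  let PE : Finset (Fin n × Fin n) := univ.filter (fun x => D x.1 x.2)
  have hPE : PE.card ≤ δ * n := by
    have : PE ⊆ (univ : Finset (Fin n)).biUnion
        (fun u => (univ.filter (fun v => D u v)).image (fun v => (u, v))) := by
      rintro ⟨u, v⟩ h
      simpa [PE] using h
    refine (Finset.card_le_card this).trans ((Finset.card_biUnion_le_card_mul _ _ δ ?_).trans ?_)
    · intro u _
      exact Finset.card_image_le.trans (hδ u)
    · simp [mul_comm]
  let PT : Finset (Fin n × Fin n × Fin n) :=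
    univ.filter (fun x => D x.1 x.2.1 ∧ deg G x.2.1 ≤ deg G x.1 ∧ G.Adj x.2.1 x.2.2)
  have hPT : PT.card ≤ 2 * δ ^ 2 * n := by
    have : PT ⊆ (univ : Finset (Fin n)).biUnion
        (fun w => (univ.filter (fun v => D w v ∧ deg G v ≤ deg G w)).biUnion
          (fun v => (univ.filter (fun u => G.Adj v u)).image (fun u => (w, v, u)))) := by
      rintro ⟨w, v, u⟩ h
      simpa [PT, and_assoc] using h
    refine (Finset.card_le_card this).trans (Finset.card_biUnion_le.trans ?_)
    calc _ ≤ ∑ w : Fin n, δ * deg G w := by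
          refine Finset.sum_le_sum (fun w _ => ?_)
          refine (Finset.card_biUnion_le_card_mul _ _ (deg G w) ?_).trans ?_
          · intro v hv
            refine Finset.card_image_le.trans (le_trans (le_of_eq ?_) (by simpa using (mem_filter.1 hv).2.2))
            unfold deg
            rw [Set.ncard_eq_toFinset_card']
            congr 1
            ext; simp
          · refine Nat.mul_le_mul_right _ (le_trans (Finset.card_le_card ?_) (hδ w))
            intro v hv
            simp only [mem_filter, mem_univ, true_and] at hv ⊢
            exact hv.1
      _ ≤ δ * (2 * δ * n) := by
          rw [← Finset.mul_sum]; exact Nat.mul_le_mul_left _ (sum_deg_le G D hD hδ)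
      _ = 2 * δ ^ 2 * n := by ring
  rcases a with _ | a
  · rcases b with _ | b
    · have : (univ.filter (fun W => Cov G D 0 0 W)) ⊆ {∅} := by
        intro W hW
        simp only [mem_filter, mem_univ, true_and, mem_singleton] at hW ⊢
        cases hW; rfl
      simpa [covConst] using Finset.card_le_card this
    · have : (univ.filter (fun W => Cov G D 0 (b + 1) W)) = ∅ := by
        ext W
        simp only [mem_filter, mem_univ, true_and, Finset.notMem_empty, iff_false]
        intro hW
        cases hW
      simp [this]
  let SE : Finset (Finset (Fin n)) := univ.filter (fun W => ∃ b' W' u v, b = b' + 1 ∧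
    Cov G D a b' W' ∧ D u v ∧ W = insert u (insert v W'))
  let SO : Finset (Finset (Fin n)) := univ.filter (fun W => ∃ W' u v,
    Cov G D a b W' ∧ u ∈ W' ∧ D u v ∧ W = insert v W')
  let ST : Finset (Finset (Fin n)) := univ.filter (fun W => ∃ a' b' W' w v u, a = a' + 1 ∧
    b = b' + 1 ∧ Cov G D a' b' W' ∧ D w v ∧ deg G v ≤ deg G w ∧ G.Adj v u ∧
    W = insert w (insert v (insert u W')))
  have hsub : univ.filter (fun W => Cov G D (a + 1) b W) ⊆ SE ∪ (SO ∪ ST) := by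
    intro W hW
    simp only [mem_filter, mem_univ, true_and] at hW
    simp only [SE, SO, ST, mem_union, mem_filter, mem_univ, true_and]
    cases hW with
    | edge u v h hD => exact Or.inl ⟨_, _, u, v, rfl, h, hD, rfl⟩
    | out u v h hu hD => exact Or.inr (Or.inl ⟨_, u, v, h, hu, hD, rfl⟩)
    | tri w v u h hD hd hA =>
      exact Or.inr (Or.inr ⟨_, _, _, w, v, u, rfl, rfl, h, hD, hd, hA, rfl⟩)
  have hSE : SE.card ≤ covConst a * δ ^ (a + 1) * n ^ b := by
    rcases b with _ | b
    · have : SE = ∅ := by ext W; simp [SE]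
      simp [this]
    · have : SE ⊆ (univ.filter (fun W => Cov G D a b W)).biUnion
          (fun W => PE.image (fun x => insert x.1 (insert x.2 W))) := by
        intro W hW
        simp only [SE, mem_filter, mem_univ, true_and] at hW
        obtain ⟨b', W', u, v, hb, h, hD, rfl⟩ := hW
        obtain rfl : b = b' := by omega
        simp only [mem_biUnion, mem_filter, mem_univ, true_and, mem_image]
        exact ⟨W', h, (u, v), by simpa [PE] using hD, rfl⟩
      refine (Finset.card_le_card this).trans
        ((Finset.card_biUnion_le_card_mul _ _ (δ * n) ?_).trans ?_)
      · intro W _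
        exact Finset.card_image_le.trans hPE
      · refine (Nat.mul_le_mul_right _ (ih a (by omega) b)).trans (le_of_eq ?_)
        ring
  have hSO : SO.card ≤ 2 * a * covConst a * δ ^ (a + 1) * n ^ b := by
    have : SO ⊆ (univ.filter (fun W => Cov G D a b W)).biUnion
        (fun W => W.biUnion (fun u => (univ.filter (fun v => D u v)).image
          (fun v => insert v W))) := by
      intro W hW
      simp only [SO, mem_filter, mem_univ, true_and] at hW
      obtain ⟨W', u, v, h, hu, hD, rfl⟩ := hW
      simp only [mem_biUnion, mem_filter, mem_univ, true_and, mem_image]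
      exact ⟨W', h, u, hu, v, hD, rfl⟩
    refine (Finset.card_le_card this).trans
      ((Finset.card_biUnion_le_card_mul _ _ (2 * a * δ) ?_).trans ?_)
    · intro W hW
      refine (Finset.card_biUnion_le_card_mul _ _ δ ?_).trans ?_
      · intro u _
        exact Finset.card_image_le.trans (hδ u)
      · exact Nat.mul_le_mul_right _ (Cov.card_le (mem_filter.1 hW).2)
    · refine (Nat.mul_le_mul_right _ (ih a (by omega) b)).trans (le_of_eq ?_)
      ring
  have hST : ST.card ≤ 2 * covConst a * δ ^ (a + 1) * n ^ b := by
    rcases b with _ | b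
    · have : ST = ∅ := by ext W; simp [ST]
      simp [this]
    rcases a with _ | a
    · have : ST = ∅ := by ext W; simp [ST]
      simp [this]
    · have : ST ⊆ (univ.filter (fun W => Cov G D a b W)).biUnion
          (fun W => PT.image (fun x => insert x.1 (insert x.2.1 (insert x.2.2 W)))) := by
        intro W hW
        simp only [ST, mem_filter, mem_univ, true_and] at hW
        obtain ⟨a', b', W', w, v, u, ha, hb, h, hD, hd, hA, rfl⟩ := hW
        obtain rfl : b = b' := by omega
        obtain rfl : a = a' := by omega
        simp only [mem_biUnion, mem_filter, mem_univ, true_and, mem_image]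
        exact ⟨W', h, (w, v, u), by simpa [PT] using ⟨hD, hd, hA⟩, rfl⟩
      refine (Finset.card_le_card this).trans
        ((Finset.card_biUnion_le_card_mul _ _ (2 * δ ^ 2 * n) ?_).trans ?_)
      · intro W _
        exact Finset.card_image_le.trans hPT
      · refine (Nat.mul_le_mul_right _ (ih a (by omega) b)).trans ?_
        have hc : covConst a ≤ covConst (a + 1) := by
          rw [covConst.eq_2]
          exact Nat.le_mul_of_pos_left _ (by omega)
        calc _ = 2 * covConst a * δ ^ (a + 1 + 1) * n ^ (b + 1) := by ring
          _ ≤ _ := by gcongr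
  calc _ ≤ (SE ∪ (SO ∪ ST)).card := Finset.card_le_card hsub
    _ ≤ SE.card + (SO.card + ST.card) :=
      (Finset.card_union_le _ _).trans (Nat.add_le_add_left (Finset.card_union_le _ _) _)
    _ ≤ covConst a * δ ^ (a + 1) * n ^ b + (2 * a * covConst a * δ ^ (a + 1) * n ^ b
        + 2 * covConst a * δ ^ (a + 1) * n ^ b) := by gcongr
    _ = (2 * a + 3) * covConst a * δ ^ (a + 1) * n ^ b := by ring
    _ ≤ covConst (a + 1) * δ ^ (a + 1) * n ^ b := by
      rw [covConst.eq_2]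
      gcongr
      omega

open Classical in
theorem exists_orientation {n : ℕ} (G : SimpleGraph (Fin n)) :
    ∃ D : Fin n → Fin n → Prop, (∀ u v, G.Adj u v → D u v ∨ D v u) ∧
      ∀ u, (univ.filter (fun v => D u v)).card ≤ degeneracy G := by
  have hmem : degeneracy G ∈ {d : ℕ | ∀ s : Finset (Fin n), s.Nonempty →
      ∃ v ∈ s, ((s : Set (Fin n)) ∩ {u | G.Adj v u}).ncard ≤ d} := by
    apply Nat.sInf_mem
    refine ⟨n, fun s hs => ?_⟩
    obtain ⟨v, hv⟩ := hs
    refine ⟨v, hv, ?_⟩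
    exact (Set.ncard_le_ncard (Set.subset_univ _)).trans (by simp [Set.ncard_univ])
  have key : ∀ m : ℕ, ∀ s : Finset (Fin n), s.card = m → ∃ D : Fin n → Fin n → Prop,
      (∀ u ∈ s, ∀ v ∈ s, G.Adj u v → D u v ∨ D v u) ∧
      ∀ u, (univ.filter (fun v => D u v)).card ≤ degeneracy G := by
    intro m
    induction m with
    | zero =>
      intro s hs
      rw [Finset.card_eq_zero] at hs
      subst hs
      exact ⟨fun _ _ => False, by simp, by simp⟩
    | succ m ih =>
      intro s hs
      obtain ⟨v, hv, hvd⟩ := hmem s (Finset.card_pos.1 (by omega))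
      obtain ⟨D, hD, hd⟩ := ih (s.erase v) (by rw [Finset.card_erase_of_mem hv]; omega)
      refine ⟨fun x y => if x = v then y ∈ s ∧ G.Adj v y else D x y, ?_, ?_⟩
      · intro x hx y hy hxy
        by_cases h1 : x = v
        · subst h1; left; simp [hy, hxy]
        by_cases h2 : y = v
        · subst h2; right; simp [hx, hxy.symm]
        · simpa [h1, h2] using hD x (by simp [h1, hx]) y (by simp [h2, hy]) hxy
      · intro u
        by_cases h1 : u = v
        · subst h1
          rw [Set.ncard_eq_toFinset_card'] at hvd
          refine le_trans (le_of_eq ?_) hvd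
          congr 1
          ext y; simp
        · simpa [h1] using hd u
  obtain ⟨D, hD, hd⟩ := key _ univ rfl
  exact ⟨D, fun u v => hD u (mem_univ _) v (mem_univ _), hd⟩

theorem degeneracy_le {n : ℕ} (G : SimpleGraph (Fin n)) : degeneracy G ≤ n := by
  apply Nat.sInf_le
  intro s hs
  obtain ⟨v, hv⟩ := hs
  refine ⟨v, hv, ?_⟩
  exact (Set.ncard_le_ncard (Set.subset_univ _)).trans (by simp [Set.ncard_univ])

theorem path_cov {n : ℕ} {G : SimpleGraph (Fin n)} {D : Fin n → Fin n → Prop}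
    (hD : ∀ u v, G.Adj u v → D u v ∨ D v u) (f : ℤ → Fin n)
    (hadj : ∀ i, G.Adj (f i) (f (i + 1))) (s : ℤ) (m : ℕ) :
    ∃ W, Cov G D m m W ∧ ∀ i, s ≤ i → i < s + 2 * m → f i ∈ W := by
  induction m with
  | zero => exact ⟨∅, Cov.nil, fun i h1 h2 => by simp at h2; omega⟩
  | succ m ih =>
    obtain ⟨W, hW, hc⟩ := ih
    have key : ∃ W', Cov G D (m + 1) (m + 1) W' ∧ W ⊆ W' ∧ f (s + 2 * m) ∈ W' ∧
        f (s + 2 * m + 1) ∈ W' := by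
      rcases hD _ _ (hadj (s + 2 * m)) with h | h
      · refine ⟨_, Cov.edge _ _ hW h, fun x hx => ?_, ?_, ?_⟩ <;> simp_all
      · refine ⟨_, Cov.edge _ _ hW h, fun x hx => ?_, ?_, ?_⟩ <;> simp_all
    obtain ⟨W', hW', hsub, h1, h2⟩ := key
    refine ⟨W', hW', fun i hi1 hi2 => ?_⟩
    push_cast at hi2
    by_cases ha : i < s + 2 * m
    · exact hsub (hc i hi1 ha)
    · by_cases hb : i = s + 2 * m
      · rw [hb]; exact h1
      · have : i = s + 2 * m + 1 := by omega
        rw [this]; exact h2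

theorem triple_cov {n : ℕ} {G : SimpleGraph (Fin n)} {D : Fin n → Fin n → Prop}
    (hD : ∀ u v, G.Adj u v → D u v ∨ D v u)
    (hdeg : ∀ i j : Fin n, j < i → deg G i ≤ deg G j) {u v w : Fin n}
    (huv : G.Adj v u) (hvw : G.Adj v w) (hlt : w < v) :
    ∃ W, Cov G D 2 1 W ∧ u ∈ W ∧ v ∈ W ∧ w ∈ W := by
  rcases hD _ _ hvw with h | h
  · have : ∃ W, Cov G D 1 1 W ∧ u ∈ W ∧ v ∈ W := by
      rcases hD _ _ huv with h | h
      · exact ⟨_, Cov.edge _ _ Cov.nil h, by simp, by simp⟩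
      · exact ⟨_, Cov.edge _ _ Cov.nil h, by simp, by simp⟩
    obtain ⟨W, hW, hu, hv⟩ := this
    exact ⟨_, Cov.out v w hW hv h, by simp [hu], by simp [hv], by simp⟩
  · exact ⟨_, Cov.tri w v u Cov.nil h (hdeg _ _ hlt) huv, by simp, by simp, by simp⟩

theorem mem_of_window {n : ℕ} {f : ℤ → Fin n} {k : ℤ} (hk : 0 < k)
    (hp : Function.Periodic f k) {W : Finset (Fin n)} (s : ℤ)
    (h : ∀ i, s ≤ i → i < s + k → f i ∈ W) (i : ℤ) : f i ∈ W := by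
  have h1 : f i = f (s + (i - s) % k) := by
    have := hp.int_mul ((i - s) / k) (s + (i - s) % k)
    rw [← this]
    congr 1
    have := Int.emod_add_mul_ediv (i - s) k
    simp only [Int.cast_id]
    linarith [mul_comm k ((i - s) / k)]
  rw [h1]
  exact h _ (by linarith [Int.emod_nonneg (i - s) hk.ne']) (by linarith [Int.emod_lt_of_pos (i - s) hk])

theorem odd_cov {n : ℕ} {G : SimpleGraph (Fin n)} {D : Fin n → Fin n → Prop}
    (hD : ∀ u v, G.Adj u v → D u v ∨ D v u)
    (hdeg : ∀ i j : Fin n, j < i → deg G i ≤ deg G j) (f : ℤ → Fin n)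
    (hadj : ∀ i, G.Adj (f i) (f (i + 1))) (m : ℕ)
    (hp : Function.Periodic f (2 * m + 3 : ℤ)) :
    ∃ W, Cov G D (m + 2) (m + 1) W ∧ ∀ i, f i ∈ W := by
  have key : ∃ s : ℤ, ∃ W, Cov G D 2 1 W ∧ f s ∈ W ∧ f (s + 1) ∈ W ∧ f (s + 2) ∈ W := by
    rcases lt_or_gt_of_ne (hadj 0).ne with h | h
    · obtain ⟨W, h1, h2, h3, h4⟩ := triple_cov hD hdeg (hadj (0 + 1)) (hadj 0).symm h
      exact ⟨0, W, h1, h4, h3, by simpa using h2⟩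
    · have h0 := hadj (-1)
      obtain ⟨W, h1, h2, h3, h4⟩ := triple_cov hD hdeg h0.symm (hadj 0) h
      exact ⟨-1, W, h1, h2, h3, by simpa using h4⟩
  obtain ⟨s, W, hW, h0, h1, h2⟩ := key
  obtain ⟨W', hW', hc⟩ := path_cov hD f hadj (s + 3) m
  refine ⟨W' ∪ W, hW'.union hW, mem_of_window (by omega) hp s (fun i hi1 hi2 => ?_)⟩
  rw [mem_union]
  by_cases a0 : i = s
  · subst a0; exact Or.inr h0
  by_cases a1 : i = s + 1
  · subst a1; exact Or.inr h1
  by_cases a2 : i = s + 2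
  · subst a2; exact Or.inr h2
  · exact Or.inl (hc i (by omega) (by omega))

/-- Even cycle with a monotone triple at positions `0, 1, 2`, first edge directed inwards. -/
theorem even_cov_aux {n : ℕ} {G : SimpleGraph (Fin n)} {D : Fin n → Fin n → Prop}
    (hD : ∀ u v, G.Adj u v → D u v ∨ D v u)
    (hdeg : ∀ i j : Fin n, j < i → deg G i ≤ deg G j) (f : ℤ → Fin n)
    (hadj : ∀ i, G.Adj (f i) (f (i + 1))) (m : ℕ)
    (hp : Function.Periodic f (2 * m + 4 : ℤ))
    (hmono : (f 0 < f 1 ∧ f 1 < f 2) ∨ (f 2 < f 1 ∧ f 1 < f 0))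
    (h01 : D (f 0) (f 1)) :
    ∃ W, Cov G D (m + 3) (m + 1) W ∧ ∀ i, f i ∈ W := by
  have a0 := hadj 0
  have a1 := hadj 1
  have a2 := hadj (-1)
  norm_num at a0 a1 a2
  rcases hD _ _ a2 with h | h
  · obtain ⟨W, hW, hc⟩ := path_cov hD f hadj 2 (m + 1)
    have hm : f (-1) ∈ W := by
      rw [← hp (-1)]
      exact hc _ (by omega) (by push_cast; omega)
    refine ⟨_, Cov.out _ _ (Cov.out _ _ hW hm h) (by simp) h01,
      mem_of_window (by omega) hp 0 (fun i hi1 hi2 => ?_)⟩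
    rw [mem_insert, mem_insert]
    by_cases b0 : i = 0
    · subst b0; simp
    by_cases b1 : i = 1
    · subst b1; simp
    · exact Or.inr (Or.inr (hc i (by omega) (by push_cast; omega)))
  · have : ∃ W, Cov G D 2 1 W ∧ f 0 ∈ W ∧ f 1 ∈ W ∧ f 2 ∈ W := by
      rcases hmono with ⟨hx, -⟩ | ⟨hx, -⟩
      · obtain ⟨W, h1, h2, h3, h4⟩ := triple_cov hD hdeg a1 a0.symm hx
        exact ⟨W, h1, h4, h3, h2⟩
      · obtain ⟨W, h1, h2, h3, h4⟩ := triple_cov hD hdeg a0.symm a1 hx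
        exact ⟨W, h1, h2, h3, h4⟩
    obtain ⟨W, hW, m0, m1, m2⟩ := this
    obtain ⟨W', hW', hc⟩ := path_cov hD f hadj 3 m
    refine ⟨_, Cov.out _ _ (hW'.union hW) (mem_union_right _ m0) h,
      mem_of_window (by omega) hp (-1) (fun i hi1 hi2 => ?_)⟩
    rw [mem_insert, mem_union]
    by_cases b : i = -1
    · subst b; simp
    by_cases b0 : i = 0
    · subst b0; simp [m0]
    by_cases b1 : i = 1
    · subst b1; simp [m1]
    by_cases b2 : i = 2
    · subst b2; simp [m2]
    · exact Or.inr (Or.inl (hc i (by omega) (by omega)))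

/-- Even cycle with centre of the monotone triple directed outwards, decreasing case. -/
theorem even_cov_aux2 {n : ℕ} {G : SimpleGraph (Fin n)} {D : Fin n → Fin n → Prop}
    (hD : ∀ u v, G.Adj u v → D u v ∨ D v u)
    (hdeg : ∀ i j : Fin n, j < i → deg G i ≤ deg G j) (f : ℤ → Fin n)
    (hadj : ∀ i, G.Adj (f i) (f (i + 1))) (m : ℕ)
    (hp : Function.Periodic f (2 * m + 4 : ℤ))
    (hlt : f 1 < f 0) (h10 : D (f 1) (f 0)) (h12 : D (f 1) (f 2)) :
    ∃ W, Cov G D (m + 3) (m + 1) W ∧ ∀ i, f i ∈ W := by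
  have a2 := hadj (-1)
  norm_num at a2
  obtain ⟨W', hW', hc⟩ := path_cov hD f hadj 3 m
  refine ⟨_, Cov.out (f 1) (f 2) (Cov.tri (f 1) (f 0) (f (-1)) hW' h10 (hdeg _ _ hlt) a2.symm)
    (by simp) h12, mem_of_window (by omega) hp (-1) (fun i hi1 hi2 => ?_)⟩
  by_cases b : i = -1
  · subst b; simp
  by_cases b0 : i = 0
  · subst b0; simp
  by_cases b1 : i = 1
  · subst b1; simp
  by_cases b2 : i = 2
  · subst b2; simp
  · have := hc i (by omega) (by omega)
    simp [this]

theorem even_cov {n : ℕ} {G : SimpleGraph (Fin n)} {D : Fin n → Fin n → Prop}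
    (hD : ∀ u v, G.Adj u v → D u v ∨ D v u)
    (hdeg : ∀ i j : Fin n, j < i → deg G i ≤ deg G j) (f : ℤ → Fin n)
    (hadj : ∀ i, G.Adj (f i) (f (i + 1))) (m : ℕ)
    (hp : Function.Periodic f (2 * m + 4 : ℤ))
    (hmono : (f 0 < f 1 ∧ f 1 < f 2) ∨ (f 2 < f 1 ∧ f 1 < f 0)) :
    ∃ W, Cov G D (m + 3) (m + 1) W ∧ ∀ i, f i ∈ W := by
  have a0 := hadj 0
  have a1 := hadj 1
  norm_num at a0 a1
  -- the reflected cycle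
  have radj : ∀ i : ℤ, G.Adj (f (2 - i)) (f (2 - (i + 1))) := by
    intro i
    have := (hadj (2 - (i + 1))).symm
    have e : 2 - (i + 1) + 1 = 2 - i := by ring
    rwa [e] at this
  have rp : Function.Periodic (fun i : ℤ => f (2 - i)) (2 * m + 4 : ℤ) := by
    intro i
    have := hp (2 - (i + (2 * m + 4)))
    simp only
    rw [← this]
    congr 1
    ring
  have back : (∃ W, Cov G D (m + 3) (m + 1) W ∧ ∀ i : ℤ, f (2 - i) ∈ W) →
      ∃ W, Cov G D (m + 3) (m + 1) W ∧ ∀ i, f i ∈ W := by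
    rintro ⟨W, hW, hc⟩
    refine ⟨W, hW, fun i => ?_⟩
    have := hc (2 - i)
    simpa using this
  rcases hD _ _ a0 with h01 | h10
  · exact even_cov_aux hD hdeg f hadj m hp hmono h01
  rcases hD _ _ a1 with h12 | h21
  · rcases hmono with ⟨-, hx⟩ | ⟨-, hx⟩
    · exact back (even_cov_aux2 hD hdeg (fun i => f (2 - i)) radj m rp
        (by norm_num; exact hx) (by norm_num; exact h12) (by norm_num; exact h10))
    · exact even_cov_aux2 hD hdeg f hadj m hp hx h10 h12
  · exact back (even_cov_aux hD hdeg (fun i => f (2 - i)) radj m rp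
      (by norm_num; tauto) (by norm_num; exact h21))

theorem cycle_cov {n : ℕ} {G : SimpleGraph (Fin n)} {D : Fin n → Fin n → Prop}
    (hD : ∀ u v, G.Adj u v → D u v ∨ D v u)
    (hdeg : ∀ i j : Fin n, j < i → deg G i ≤ deg G j) {k : ℕ} (l : Fin k → Fin n)
    (hl : IsCycleTuple G l) :
    ∃ a b W, a + b = k ∧ b ≤ a ∧ (HasMonoTriple l → b < a) ∧ Cov G D a b W ∧
      ∀ i, l i ∈ W := by
  obtain ⟨hk, -, hA⟩ := hl
  have hk0 : (0 : ℤ) < k := by omega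
  let g : ℤ → Fin k := fun i => ⟨(i % k).toNat, by
    have := Int.emod_lt_of_pos i hk0
    have := Int.emod_nonneg i hk0.ne'
    omega⟩
  have gval : ∀ i, ((g i : ℕ) : ℤ) = i % k := fun i =>
    Int.toNat_of_nonneg (Int.emod_nonneg i hk0.ne')
  have gs : ∀ i, ((g i : ℕ) + 1) % k = (g (i + 1) : ℕ) := by
    intro i
    zify
    rw [gval, gval, Int.emod_add_emod]
  have gc : ∀ i : Fin k, g (i : ℕ) = i := by
    intro i
    apply Fin.ext
    zify
    rw [gval]
    exact Int.emod_eq_of_lt (by omega) (by have := i.2; omega)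
  have gp : ∀ i, g (i + k) = g i := by
    intro i
    apply Fin.ext
    zify
    rw [gval, gval]; simp
  have fadj : ∀ i, G.Adj (l (g i)) (l (g (i + 1))) := fun i => hA _ _ (gs i)
  have fp : Function.Periodic (fun i => l (g i)) (k : ℤ) := fun i => by simp only [gp]
  have fin : ∀ W : Finset (Fin n), (∀ i, l (g i) ∈ W) → ∀ i, l i ∈ W := by
    intro W h i
    have := h (i : ℕ)
    rwa [gc] at this
  rcases Nat.even_or_odd' k with ⟨q, hq | hq⟩
  · by_cases hm : HasMonoTriple l
    · obtain ⟨i, j, t, hij, hjt, hmono⟩ := hm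
      obtain ⟨m, rfl⟩ : ∃ m, q = m + 2 := ⟨q - 2, by omega⟩
      have ej : g ((i : ℕ) + 1) = j := by
        apply Fin.ext; rw [← gs, gc, hij]
      have et : g ((i : ℕ) + 2) = t := by
        apply Fin.ext
        have : ((i : ℕ) : ℤ) + 2 = (i : ℕ) + 1 + 1 := by ring
        rw [this, ← gs, ej, hjt]
      obtain ⟨W, hW, hc⟩ := even_cov hD hdeg (fun s => l (g ((i : ℕ) + s)))
        (fun s => by have := fadj ((i : ℕ) + s); rwa [add_assoc] at this) m
        (fun s => by
          have : ((i : ℕ) : ℤ) + (s + (2 * m + 4)) = (i : ℕ) + s + (k : ℕ) := by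
            omega
          simp only
          rw [this, gp])
        (by simp only [add_zero, gc, ej, et]; tauto)
      refine ⟨_, _, W, by omega, by omega, fun _ => by omega, hW, fin W (fun s => ?_)⟩
      have := hc (s - (i : ℕ))
      simpa using this
    · obtain ⟨W, hW, hc⟩ := path_cov hD (fun i => l (g i)) fadj 0 q
      refine ⟨q, q, W, by omega, le_rfl, fun h => absurd h hm, hW, fin W ?_⟩
      exact mem_of_window hk0 fp 0 (fun i h1 h2 => hc i h1 (by omega))
  · obtain ⟨m, rfl⟩ : ∃ m, q = m + 1 := ⟨q - 1, by omega⟩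
    obtain ⟨W, hW, hc⟩ := odd_cov hD hdeg (fun i => l (g i)) fadj m
      (by
        have : (k : ℤ) = 2 * m + 3 := by rw [hq]; push_cast; ring
        rw [← this]; exact fp)
    exact ⟨_, _, W, by omega, by omega, fun _ => by omega, hW, fin W hc⟩

theorem cov_biUnion {n : ℕ} {G : SimpleGraph (Fin n)} {D : Fin n → Fin n → Prop}
    {ι : Type*} [DecidableEq ι] (s : Finset ι) (a b : ι → ℕ) (W : ι → Finset (Fin n))
    (h : ∀ t, Cov G D (a t) (b t) (W t)) :
    Cov G D (∑ t ∈ s, a t) (∑ t ∈ s, b t) (s.biUnion W) := by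
  induction s using Finset.induction_on with
  | empty => simpa using Cov.nil
  | insert t s ht ih =>
    rw [Finset.sum_insert ht, Finset.sum_insert ht, Finset.biUnion_insert]
    exact (h t).union ih

theorem ncard_cycles {n : ℕ} {G : SimpleGraph (Fin n)} {c : ℕ} (k : Fin c → ℕ)
    (l : (t : Fin c) → Fin (k t) → Fin n) (hl : ∀ t, IsCycleTuple G (l t))
    (hdisj : ∀ t t', t ≠ t' → ∀ i j, l t i ≠ l t' j) :
    (⋃ t, cycleEdges (l t)).ncard = ∑ t, k t := by
  let nx : (t : Fin c) → Fin (k t) → Fin (k t) := fun t i =>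
    ⟨((i : ℕ) + 1) % k t, Nat.mod_lt _ (by have := (hl t).1; omega)⟩
  let φ : (Σ t, Fin (k t)) → Sym2 (Fin n) := fun x => s(l x.1 x.2, l x.1 (nx x.1 x.2))
  have hr : (⋃ t, cycleEdges (l t)) = Set.range φ := by
    ext e
    simp only [Set.mem_iUnion, cycleEdges, Set.mem_ofPred_eq, Set.mem_range, φ]
    constructor
    · rintro ⟨t, i, j, hij, rfl⟩
      refine ⟨⟨t, i⟩, ?_⟩
      have : nx t i = j := Fin.ext hij
      simp only [this]
    · rintro ⟨⟨t, i⟩, rfl⟩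
      exact ⟨t, i, nx t i, rfl, rfl⟩
  have hinj : Function.Injective φ := by
    rintro ⟨t, i⟩ ⟨t', i'⟩ h
    have ht : t = t' := by
      by_contra hne
      simp only [φ, Sym2.eq_iff] at h
      rcases h with h | h
      · exact hdisj t t' hne _ _ h.1
      · exact hdisj t t' hne _ _ h.1
    subst ht
    obtain ⟨hk, hli, -⟩ := hl t
    simp only [φ, Sym2.eq_iff] at h
    rcases h with h | h
    · rw [hli h.1]
    · exfalso
      have h1 := congrArg Fin.val (hli h.1)
      have h2 := congrArg Fin.val (hli h.2)
      simp only [nx] at h1 h2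
      have hi := i.2
      have hi' := i'.2
      rcases Nat.lt_or_ge ((i : ℕ) + 1) (k t) with q1 | q1 <;>
      rcases Nat.lt_or_ge ((i' : ℕ) + 1) (k t) with q2 | q2
      · rw [Nat.mod_eq_of_lt q1] at h2
        rw [Nat.mod_eq_of_lt q2] at h1
        omega
      · have : (i' : ℕ) + 1 = k t := by omega
        rw [this, Nat.mod_self] at h1
        rw [Nat.mod_eq_of_lt q1] at h2
        omega
      · have : (i : ℕ) + 1 = k t := by omega
        rw [this, Nat.mod_self] at h2
        rw [Nat.mod_eq_of_lt q2] at h1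
        omega
      · have e1 : (i : ℕ) + 1 = k t := by omega
        have e2 : (i' : ℕ) + 1 = k t := by omega
        rw [e1, Nat.mod_self] at h2
        omega
  rw [hr, ← Set.image_univ, Set.ncard_image_of_injective _ hinj, Set.ncard_univ]
  simp


/-- Fix `p ∈ ℕ`.  In a graph on `n` vertices with degeneracy `δ` whose vertices are
indexed in non-increasing order of degree, the number of edge sets of size `2p` that can
be partitioned into vertex-disjoint cycles, at least one of which contains three
consecutive vertices of monotonic index, is `O(δ^(p+1) n^(p-1))`. -/
theorem card_cycle_edge_sets_bigO (p : ℕ) :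
    ∃ C : ℕ, ∀ (n : ℕ) (G : SimpleGraph (Fin n)),
      (∀ i j : Fin n, j < i → deg G i ≤ deg G j) →
      {F : Set (Sym2 (Fin n)) | F ⊆ G.edgeSet ∧ F.ncard = 2 * p ∧
        ∃ (c : ℕ) (_ : 0 < c) (k : Fin c → ℕ) (l : (t : Fin c) → Fin (k t) → Fin n),
          (∀ t, IsCycleTuple G (l t)) ∧
          (∀ t t', t ≠ t' → ∀ i j, l t i ≠ l t' j) ∧
          F = ⋃ t, cycleEdges (l t) ∧
          ∃ t, HasMonoTriple (l t)}.ncard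
        ≤ C * degeneracy G ^ (p + 1) * n ^ (p - 1) := by
  classical
  refine ⟨∑ j ∈ Finset.range (p + 1), covConst (p + j) * 2 ^ ((4 * p + 1).choose 2), ?_⟩
  intro n G hdeg
  obtain ⟨D, hD, hδ⟩ := exists_orientation G
  set δ := degeneracy G with hδdef
  have hδn : δ ≤ n := degeneracy_le G
  let S : ℕ → Finset (Finset (Fin n)) := fun j =>
    univ.filter (fun W => Cov G D (p + j) (p - j) W)
  let T : Finset (Set (Sym2 (Fin n))) := (Finset.Icc 1 p).biUnion (fun j =>
    (S j).biUnion (fun W => W.sym2.powerset.image (fun E : Finset (Sym2 (Fin n)) => (E : Set (Sym2 (Fin n))))))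
  have hT : T.card ≤ (∑ j ∈ Finset.range (p + 1), covConst (p + j) * 2 ^ ((4 * p + 1).choose 2))
      * δ ^ (p + 1) * n ^ (p - 1) := by
    refine Finset.card_biUnion_le.trans ?_
    rw [Finset.sum_mul, Finset.sum_mul]
    refine le_trans (Finset.sum_le_sum (g := fun j =>
      covConst (p + j) * 2 ^ ((4 * p + 1).choose 2) * δ ^ (p + 1) * n ^ (p - 1)) ?_) ?_
    · intro j hj
      rw [Finset.mem_Icc] at hj
      refine (Finset.card_biUnion_le_card_mul _ _ (2 ^ ((4 * p + 1).choose 2)) ?_).trans ?_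
      · intro W hW
        refine Finset.card_image_le.trans ?_
        rw [Finset.card_powerset, Finset.card_sym2]
        have := Cov.card_le (mem_filter.1 hW).2
        exact Nat.pow_le_pow_right (by norm_num) (Nat.choose_le_choose 2 (by omega))
      · refine (Nat.mul_le_mul_right _ (card_cov_le G D hD hδ (p + j) (p - j))).trans ?_
        have e : δ ^ (p + j) * n ^ (p - j) ≤ δ ^ (p + 1) * n ^ (p - 1) := by
          have e1 : p + j = p + 1 + (j - 1) := by omega
          have e2 : p - 1 = (j - 1) + (p - j) := by omega
          rw [e1, e2, pow_add, pow_add n, ← mul_assoc]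
          gcongr
        calc _ = covConst (p + j) * 2 ^ ((4 * p + 1).choose 2) * (δ ^ (p + j) * n ^ (p - j)) := by
              ring
          _ ≤ covConst (p + j) * 2 ^ ((4 * p + 1).choose 2) * (δ ^ (p + 1) * n ^ (p - 1)) := by
              gcongr
          _ = _ := by ring
    · apply Finset.sum_le_sum_of_subset
      intro j hj
      simp only [Finset.mem_Icc, Finset.mem_range] at hj ⊢
      omega
  refine le_trans ?_ hT
  rw [← Set.ncard_coe_finset]
  refine Set.ncard_le_ncard ?_ (Finset.finite_toSet _)
  rintro F ⟨-, hcard, c, -, k, l, hl, hdisj, rfl, t₀, ht₀⟩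
  rw [ncard_cycles k l hl hdisj] at hcard
  choose a b W hab hba hmono hcov hmem using fun t => cycle_cov hD hdeg (l t) (hl t)
  have hC := cov_biUnion univ a b W hcov
  have hsum : ∑ t, a t + ∑ t, b t = 2 * p := by
    rw [← Finset.sum_add_distrib, ← hcard]
    exact Finset.sum_congr rfl (fun t _ => hab t)
  have hlt : ∑ t, b t < ∑ t, a t :=
    Finset.sum_lt_sum (fun t _ => hba t) ⟨t₀, mem_univ _, hmono t₀ ht₀⟩
  obtain ⟨j, hj⟩ : ∃ j, ∑ t, a t = p + j := ⟨∑ t, a t - p, by omega⟩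
  have hj' : ∑ t, b t = p - j := by omega
  rw [hj, hj'] at hC
  simp only [T, S, Finset.mem_coe, mem_biUnion, mem_filter, mem_univ, true_and, mem_image,
    mem_powerset, Finset.mem_Icc]
  refine ⟨j, by omega, _, hC, (⋃ t, cycleEdges (l t)).toFinset, ?_, by simp⟩
  intro e he
  rw [Set.mem_toFinset, Set.mem_iUnion] at he
  obtain ⟨t, i, j, -, rfl⟩ := he
  rw [Finset.mk_mem_sym2_iff]
  exact ⟨mem_biUnion.2 ⟨t, mem_univ _, hmem t i⟩, mem_biUnion.2 ⟨t, mem_univ _, hmem t j⟩⟩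
end
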